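/- Let n ∈ ℤ≥0 and let a, b, c, x be nonzero complex numbers such that (ab;q)_j ≠ 0, (ac;q)_j ≠ 0 and (q·a/c;q)_j ≠ 0 for all 0 ≤ j ≤ n. Then the following identity of terminating sums holds: ∑_{j=0}^{n} [(a²qⁿ;q)_j (q⁻ⁿ;q)_j (−1/x;q)_j / ((ab;q)_j (ac;q)_j (q;q)_j)] (−b·c·x)^j = [(c·q⁻ⁿ/a;q)_n / (ac;q)_n] · ∑_{j=0}^{n} [(q⁻ⁿ;q)_j (a²qⁿ;q)_j (−a·b·x;q)_j / ((ab;q)_j (q·a/c;q)_j (q;q)_j)] q^j. -/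

import Mathlib

/-- The q-shifted factorial `(a;q)_n = ∏_{j=0}^{n-1} (1 - a q^j)`. -/
noncomputable def qPoch (a q : ℂ) (n : ℕ) : ℂ := ∏ j ∈ Finset.range n, (1 - a * q ^ j)

open Finset (range)
open Finset.HasAntidiagonal (antidiagonal mem_antidiagonal)

/-- The shifted power `∏_{i<n} (u - d q^i)`. -/
noncomputable def qShiftedPow (u d q : ℂ) (n : ℕ) : ℂ := ∏ i ∈ range n, (u - d * q ^ i)

@[simp] lemma qPoch_zero (a q : ℂ) : qPoch a q 0 = 1 := by simp [qPoch]

@[simp] lemma qShiftedPow_zero (u d q : ℂ) : qShiftedPow u d q 0 = 1 := by simp [qShiftedPow]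

lemma qPoch_succ (a q : ℂ) (n : ℕ) : qPoch a q (n + 1) = qPoch a q n * (1 - a * q ^ n) := by
  simp [qPoch, Finset.prod_range_succ]

lemma qPoch_succ' (a q : ℂ) (n : ℕ) : qPoch a q (n + 1) = (1 - a) * qPoch (a * q) q n := by
  simp [qPoch, Finset.prod_range_succ', pow_succ', mul_assoc, mul_comm]

lemma qPoch_add (a q : ℂ) (k m : ℕ) :
    qPoch a q (k + m) = qPoch a q k * qPoch (a * q ^ k) q m := by
  simp [qPoch, Finset.prod_range_add, pow_add, mul_assoc]

lemma qShiftedPow_succ (u d q : ℂ) (n : ℕ) :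
    qShiftedPow u d q (n + 1) = qShiftedPow u d q n * (u - d * q ^ n) := by
  simp [qShiftedPow, Finset.prod_range_succ]

lemma qShiftedPow_succ' (u d q : ℂ) (n : ℕ) :
    qShiftedPow u d q (n + 1) = (u - d) * qShiftedPow u (d * q) q n := by
  simp [qShiftedPow, Finset.prod_range_succ', pow_succ', mul_assoc, mul_comm]

lemma qShiftedPow_mul (u d t q : ℂ) (n : ℕ) :
    qShiftedPow (u * t) (d * t) q n = t ^ n * qShiftedPow u d q n := by
  induction n with
  | zero => simp
  | succ n ih => rw [qShiftedPow_succ, qShiftedPow_succ, ih]; ring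

lemma qShiftedPow_mul_right (u b q : ℂ) (n : ℕ) :
    qShiftedPow u (u * b) q n = u ^ n * qPoch b q n := by
  induction n with
  | zero => simp
  | succ n ih => rw [qShiftedPow_succ, qPoch_succ, ih]; ring

lemma choose_two_succ (n : ℕ) : (n + 1).choose 2 = n.choose 2 + n := by
  rw [Nat.choose_succ_succ' n 1, Nat.choose_one_right, add_comm]

lemma choose_two_add (k m : ℕ) : (k + m).choose 2 = k.choose 2 + m.choose 2 + k * m := by
  induction m with
  | zero => simp
  | succ m ih => rw [← add_assoc, choose_two_succ, choose_two_succ, ih]; ring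

lemma sum_antidiagonal_assoc (n : ℕ) (F : ℕ → ℕ → ℕ → ℂ) :
    ∑ p ∈ antidiagonal n, ∑ r ∈ antidiagonal p.1, F r.1 r.2 p.2 =
      ∑ p ∈ antidiagonal n, ∑ r ∈ antidiagonal p.2, F p.1 r.1 r.2 := by
  rw [Finset.sum_sigma', Finset.sum_sigma']
  refine Finset.sum_nbij' (fun s ↦ ⟨(s.2.1, s.2.2 + s.1.2), (s.2.2, s.1.2)⟩)
    (fun s ↦ ⟨(s.1.1 + s.2.1, s.2.2), (s.1.1, s.2.1)⟩) ?_ ?_ ?_ ?_ ?_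
  all_goals
    rintro ⟨⟨i, j⟩, ⟨k, l⟩⟩
    simp only [Finset.mem_sigma, mem_antidiagonal]
    rintro ⟨rfl, h⟩
    simp [← h, add_assoc]

lemma one_sub_pow_succ_ne_zero {q : ℂ} (hq : ∀ n, qPoch q q n ≠ 0) (n : ℕ) : 1 - q ^ (n + 1) ≠ 0 := by
  have h := hq (n + 1)
  rw [qPoch_succ, ← pow_succ'] at h
  exact right_ne_zero_of_mul h

lemma sum_antidiagonal_succ_div_qPoch {q : ℂ} (hq : ∀ n, qPoch q q n ≠ 0) (n : ℕ)
    (h : ℕ → ℕ → ℂ) :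
    (1 - q ^ (n + 1)) * ∑ p ∈ antidiagonal (n + 1), h p.1 p.2 / (qPoch q q p.1 * qPoch q q p.2) =
      ∑ p ∈ antidiagonal n,
        (q ^ p.1 * h p.1 (p.2 + 1) + h (p.1 + 1) p.2) / (qPoch q q p.1 * qPoch q q p.2) := by
  have hsplit : (1 - q ^ (n + 1)) *
        ∑ p ∈ antidiagonal (n + 1), h p.1 p.2 / (qPoch q q p.1 * qPoch q q p.2) =
      ∑ p ∈ antidiagonal (n + 1),
          q ^ p.1 * (1 - q ^ p.2) * h p.1 p.2 / (qPoch q q p.1 * qPoch q q p.2) +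
        ∑ p ∈ antidiagonal (n + 1),
          (1 - q ^ p.1) * h p.1 p.2 / (qPoch q q p.1 * qPoch q q p.2) := by
    rw [Finset.mul_sum, ← Finset.sum_add_distrib]
    refine Finset.sum_congr rfl fun p hp ↦ ?_
    rw [← mem_antidiagonal.1 hp]
    ring
  rw [hsplit, Finset.Nat.sum_antidiagonal_succ', Finset.Nat.sum_antidiagonal_succ]
  simp only [pow_zero, sub_self, mul_zero, zero_mul, zero_div, zero_add]
  rw [← Finset.sum_add_distrib]
  refine Finset.sum_congr rfl fun p _ ↦ ?_
  have h1 := one_sub_pow_succ_ne_zero hq p.1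
  have h2 := one_sub_pow_succ_ne_zero hq p.2
  have h3 := hq p.1
  have h4 := hq p.2
  rw [qPoch_succ, qPoch_succ, ← pow_succ', ← pow_succ']
  field_simp

lemma sum_antidiagonal_succ_div_qPoch' {q : ℂ} (hq : ∀ n, qPoch q q n ≠ 0) (n : ℕ)
    (h : ℕ → ℕ → ℂ) :
    (1 - q ^ (n + 1)) * ∑ p ∈ antidiagonal (n + 1), h p.1 p.2 / (qPoch q q p.1 * qPoch q q p.2) =
      ∑ p ∈ antidiagonal n,
        (h p.1 (p.2 + 1) + q ^ p.2 * h (p.1 + 1) p.2) / (qPoch q q p.1 * qPoch q q p.2) := by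
  have key := sum_antidiagonal_succ_div_qPoch hq n fun i j ↦ h j i
  rw [← Finset.Nat.sum_antidiagonal_swap, ← Finset.Nat.sum_antidiagonal_swap (n := n)] at key
  simp only [Prod.fst_swap, Prod.snd_swap] at key
  refine (congrArg _ (Finset.sum_congr rfl fun p _ ↦ ?_)).trans
    (key.trans (Finset.sum_congr rfl fun p _ ↦ ?_)) <;> ring

/-- The `q`-Chu–Vandermonde sum for `₂φ₁(q⁻ⁿ, b; d; d qⁿ / b)`, with `u = d / b`. -/
lemma sum_qShiftedPow_mul_qPoch {q : ℂ} (hq : ∀ n, qPoch q q n ≠ 0) (n : ℕ) (u d : ℂ) :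
    ∑ p ∈ antidiagonal n, (-1) ^ p.1 * q ^ p.1.choose 2 * qShiftedPow u d q p.1 *
      qPoch (d * q ^ p.1) q p.2 / (qPoch q q p.1 * qPoch q q p.2) = qPoch u q n / qPoch q q n := by
  induction n generalizing u d with
  | zero => simp
  | succ n ih =>
    apply mul_left_cancel₀ (one_sub_pow_succ_ne_zero hq n)
    rw [sum_antidiagonal_succ_div_qPoch hq n fun i j ↦ (-1) ^ i * q ^ i.choose 2 *
      qShiftedPow u d q i * qPoch (d * q ^ i) q j]
    have hstep : (1 - q ^ (n + 1)) * (qPoch u q (n + 1) / qPoch q q (n + 1)) =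
        (1 - u) * (qPoch (u * q) q n / qPoch q q n) := by
      have h1 := one_sub_pow_succ_ne_zero hq n
      have h2 := hq n
      rw [qPoch_succ' u, qPoch_succ q, ← pow_succ']
      field_simp
    rw [hstep, ← ih (u * q) (d * q), Finset.mul_sum]
    refine Finset.sum_congr rfl fun p _ ↦ ?_
    rw [mul_div_assoc', qPoch_succ', qShiftedPow_succ, choose_two_succ, qShiftedPow_mul]
    have e1 : d * q ^ (p.1 + 1) = d * q ^ p.1 * q := by ring
    have e2 : d * q * q ^ p.1 = d * q ^ p.1 * q := by ring
    rw [e1, e2]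
    ring

/-- The `q`-Chu–Vandermonde sum for `₂φ₁(q⁻ⁿ, c; f; q)`. -/
lemma sum_qPoch_mul_qPoch {q : ℂ} (hq : ∀ n, qPoch q q n ≠ 0) (n : ℕ) (c f : ℂ) :
    ∑ p ∈ antidiagonal n, (-1) ^ p.1 * q ^ p.2.choose 2 * qPoch c q p.1 *
      qPoch (f * q ^ p.1) q p.2 / (qPoch q q p.1 * qPoch q q p.2) =
        q ^ n.choose 2 * qShiftedPow c f q n / qPoch q q n := by
  induction n generalizing f with
  | zero => simp
  | succ n ih =>
    apply mul_left_cancel₀ (one_sub_pow_succ_ne_zero hq n)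
    rw [sum_antidiagonal_succ_div_qPoch' hq n fun i j ↦ (-1) ^ i * q ^ j.choose 2 *
      qPoch c q i * qPoch (f * q ^ i) q j]
    have hstep : (1 - q ^ (n + 1)) *
          (q ^ (n + 1).choose 2 * qShiftedPow c f q (n + 1) / qPoch q q (n + 1)) =
        q ^ n * (c - f) * (q ^ n.choose 2 * qShiftedPow c (f * q) q n / qPoch q q n) := by
      have h1 := one_sub_pow_succ_ne_zero hq n
      have h2 := hq n
      rw [qShiftedPow_succ', qPoch_succ q, ← pow_succ', choose_two_succ]
      field_simp
      ring
    rw [hstep, ← ih (f * q), Finset.mul_sum]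
    refine Finset.sum_congr rfl fun p hp ↦ ?_
    rw [mul_div_assoc', qPoch_succ', qPoch_succ, choose_two_succ, ← mem_antidiagonal.1 hp]
    have e1 : f * q ^ (p.1 + 1) = f * q ^ p.1 * q := by ring
    have e2 : f * q * q ^ p.1 = f * q ^ p.1 * q := by ring
    rw [e1, e2]
    ring

/-- A terminating `₃φ₂` transformation, in a form where the only denominators are `(d;q)_k`
and `(q;q)_k`. -/
lemma sum_qPoch_transformation {q : ℂ} (hq : ∀ n, qPoch q q n ≠ 0) (n : ℕ)
    (A u d f : ℂ) (hd : ∀ j ≤ n, qPoch d q j ≠ 0) :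
    ∑ p ∈ antidiagonal n, (-1) ^ p.1 * q ^ p.2.choose 2 * qPoch A q p.1 * qPoch u q p.1 /
        qPoch d q p.1 * qPoch (f * q ^ p.1) q p.2 / (qPoch q q p.1 * qPoch q q p.2) =
      q ^ n.choose 2 * ∑ p ∈ antidiagonal n, qPoch A q p.1 * qShiftedPow u d q p.1 /
        qPoch d q p.1 * qShiftedPow A f q p.2 / (qPoch q q p.1 * qPoch q q p.2) := by
  let F (k m l : ℕ) : ℂ :=
    qPoch A q k * qShiftedPow u d q k / (qPoch d q k * qPoch q q k) * q ^ k.choose 2 *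
      ((-1) ^ m * q ^ l.choose 2 * qPoch (A * q ^ k) q m *
        qPoch (f * q ^ k * q ^ m) q l / (qPoch q q m * qPoch q q l))
  trans ∑ p ∈ antidiagonal n, ∑ r ∈ antidiagonal p.1, F r.1 r.2 p.2
  · refine Finset.sum_congr rfl fun p hp ↦ ?_
    have hsum := sum_qShiftedPow_mul_qPoch hq p.1 u d
    trans (-1) ^ p.1 * q ^ p.2.choose 2 * qPoch A q p.1 / qPoch d q p.1 *
      qPoch (f * q ^ p.1) q p.2 / qPoch q q p.2 * (qPoch u q p.1 / qPoch q q p.1)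
    · field_simp
    rw [← hsum, Finset.mul_sum]
    refine Finset.sum_congr rfl fun r hr ↦ ?_
    have hp' := mem_antidiagonal.1 hp
    have hr' := mem_antidiagonal.1 hr
    have hne := hd (r.1 + r.2) (by omega)
    rw [← hr']
    rw [qPoch_add] at hne ⊢
    rw [qPoch_add]
    have h1 := left_ne_zero_of_mul hne
    have h2 := right_ne_zero_of_mul hne
    have h3 := hq r.1
    have h4 := hq r.2
    have h5 := hq p.2
    have hsign : ((-1 : ℂ) ^ r.1) ^ 2 = 1 := by rw [← pow_mul', pow_mul]; simp
    simp only [F, mul_assoc f, ← pow_add]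
    rw [pow_add (-1 : ℂ)]
    generalize qPoch (d * q ^ r.1) q r.2 = X at h2 ⊢
    field_simp
    rw [hsign, one_mul]
  · rw [sum_antidiagonal_assoc, Finset.mul_sum]
    refine Finset.sum_congr rfl fun p hp ↦ ?_
    simp only [F]
    rw [← Finset.mul_sum, sum_qPoch_mul_qPoch hq, qShiftedPow_mul, ← mem_antidiagonal.1 hp,
      choose_two_add]
    have h1 := hd p.1 (by have := mem_antidiagonal.1 hp; omega)
    have h3 := hq p.1
    have h5 := hq p.2
    field_simp
    ring

lemma qPoch_zpow_neg_mul_qPoch {q : ℂ} (hq : q ≠ 0) (j l : ℕ) :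
    qPoch (q ^ (-((j + l : ℕ) : ℤ))) q j * qPoch q q l * q ^ ((j + l).choose 2 + j) =
      (-1) ^ j * q ^ l.choose 2 * qPoch q q (j + l) := by
  induction j generalizing l with
  | zero => simp; ring
  | succ j ih =>
    have key := ih (l + 1)
    rw [show j + 1 + l = j + (l + 1) by ring]
    have hy : q ^ (-((j + (l + 1) : ℕ) : ℤ)) * q ^ (j + (l + 1)) = 1 := by
      rw [zpow_neg, zpow_natCast, inv_mul_cancel₀ (pow_ne_zero _ hq)]
    generalize q ^ (-((j + (l + 1) : ℕ) : ℤ)) = y at key hy ⊢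
    have hfac : (1 - y * q ^ j) * q ^ (l + 1) = -(1 - q * q ^ l) := by
      linear_combination -hy
    rw [qPoch_succ q, choose_two_succ l] at key
    rw [qPoch_succ, ← add_assoc, pow_succ q (_ + j)]
    apply mul_right_cancel₀ (pow_ne_zero l hq)
    linear_combination qPoch y q j * qPoch q q l * q ^ ((j + (l + 1)).choose 2 + j) * hfac - key

lemma qPoch_mul_zpow_neg {q g : ℂ} (hq : q ≠ 0) (hg : g ≠ 0) (n : ℕ) :
    qPoch (g * q ^ (-(n : ℤ))) q n * q ^ (n + 1).choose 2 = (-g) ^ n * qPoch (q / g) q n := by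
  induction n with
  | zero => simp
  | succ n ih =>
    have e : g * q ^ (-((n + 1 : ℕ) : ℤ)) * q = g * q ^ (-(n : ℤ)) := by
      rw [mul_assoc, ← zpow_add_one₀ hq]
      congr 2
      push_cast
      ring
    rw [qPoch_succ', e, choose_two_succ (n + 1), pow_add, qPoch_succ]
    have hfac : (1 - g * q ^ (-((n + 1 : ℕ) : ℤ))) * q ^ (n + 1) =
        -g * (1 - q / g * q ^ n) := by
      rw [zpow_neg, zpow_natCast]
      field_simp
      ring
    linear_combination (1 - g * q ^ (-((n + 1 : ℕ) : ℤ))) * q ^ (n + 1) * ih +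
      (-g) ^ n * qPoch (q / g) q n * hfac

lemma qPoch_mul_qShiftedPow (q s h : ℂ) (k m : ℕ) :
    qPoch s q k * qShiftedPow (h * s * q ^ (k + m)) (h * q) q m =
      (-h) ^ m * q ^ (m + 1).choose 2 * qPoch s q (k + m) := by
  induction m generalizing k with
  | zero => simp
  | succ m ih =>
    have e : k + (m + 1) = k + 1 + m := by ring
    have key := ih (k + 1)
    rw [qPoch_succ] at key
    rw [qShiftedPow_succ, e, choose_two_succ (m + 1)]
    linear_combination (-h * q ^ (m + 1)) * key

lemma qPoch_mul_qShiftedPow_eq {q g s : ℂ} (hq : q ≠ 0) (hg : g ≠ 0) (k m : ℕ) :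
    qPoch (g * q ^ (-((k + m : ℕ) : ℤ))) q (k + m) * qPoch q q (k + m) * qPoch s q k *
        qShiftedPow (g⁻¹ * s * q ^ (k + m)) (g⁻¹ * q) q m =
      qPoch (q ^ (-((k + m : ℕ) : ℤ))) q k * g ^ k * qPoch q q m * qPoch s q (k + m) *
        qPoch (q / g) q (k + m) := by
  have h1 := qPoch_zpow_neg_mul_qPoch hq k m
  have h2 := qPoch_mul_zpow_neg hq hg (k + m)
  have h3 := qPoch_mul_qShiftedPow q s g⁻¹ k m
  have hpow : (-g) ^ (k + m) * (-g⁻¹) ^ m = (-1) ^ k * g ^ k := by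
    rw [pow_add, mul_assoc, ← mul_pow, neg_mul_neg, mul_inv_cancel₀ hg, one_pow, mul_one, neg_pow]
  apply mul_right_cancel₀ (pow_ne_zero ((k + m + 1).choose 2) hq)
  rw [choose_two_succ] at h2 h3 ⊢
  set S := qShiftedPow (g⁻¹ * s * q ^ (k + m)) (g⁻¹ * q) q m
  set Y := qPoch (q ^ (-((k + m : ℕ) : ℤ))) q k
  set f := qPoch (q / g) q (k + m)
  linear_combination qPoch q q (k + m) * (qPoch s q k * S) * h2 +
    (-g) ^ (k + m) * f * qPoch q q (k + m) * h3 +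
    f * qPoch q q (k + m) * q ^ (m.choose 2 + m) * qPoch s q (k + m) * hpow -
    g ^ k * qPoch s q (k + m) * f * q ^ m * h1

theorem bigQJacobi_polynomial_transformation (q : ℝ) (hq0 : 0 < q) (hq1 : q < 1)
    (n : ℕ) (a b c x : ℂ) (ha : a ≠ 0) (hb : b ≠ 0) (hc : c ≠ 0) (hx : x ≠ 0)
    (hab : ∀ j ≤ n, qPoch (a * b) (q : ℂ) j ≠ 0)
    (hac : ∀ j ≤ n, qPoch (a * c) (q : ℂ) j ≠ 0)
    (hqac : ∀ j ≤ n, qPoch ((q : ℂ) * a / c) (q : ℂ) j ≠ 0) :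
    ∑ j ∈ Finset.range (n + 1),
        qPoch (a ^ 2 * (q : ℂ) ^ n) (q : ℂ) j * qPoch ((q : ℂ) ^ (-(n : ℤ))) (q : ℂ) j *
          qPoch (-1 / x) (q : ℂ) j /
          (qPoch (a * b) (q : ℂ) j * qPoch (a * c) (q : ℂ) j * qPoch (q : ℂ) (q : ℂ) j) *
          (-(b * c * x)) ^ j =
      (qPoch (c * (q : ℂ) ^ (-(n : ℤ)) / a) (q : ℂ) n / qPoch (a * c) (q : ℂ) n) *
        ∑ j ∈ Finset.range (n + 1),
          qPoch ((q : ℂ) ^ (-(n : ℤ))) (q : ℂ) j * qPoch (a ^ 2 * (q : ℂ) ^ n) (q : ℂ) j *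
            qPoch (-(a * b * x)) (q : ℂ) j /
            (qPoch (a * b) (q : ℂ) j * qPoch ((q : ℂ) * a / c) (q : ℂ) j *
              qPoch (q : ℂ) (q : ℂ) j) * (q : ℂ) ^ j := by
  have hq : (q : ℂ) ≠ 0 := by exact_mod_cast hq0.ne'
  have hqq (m : ℕ) : qPoch (q : ℂ) q m ≠ 0 := by
    refine Finset.prod_ne_zero_iff.2 fun j _ ↦ sub_ne_zero.2 ?_
    rw [← pow_succ']
    exact_mod_cast (pow_lt_one₀ hq0.le hq1 j.succ_ne_zero).ne'
  generalize (q : ℂ) = Q at *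
  have hg : c / a ≠ 0 := div_ne_zero hc ha
  have hfn := hqac n le_rfl
  have hsn := hac n le_rfl
  have hright : ∑ j ∈ range (n + 1),
      qPoch (Q ^ (-(n : ℤ))) Q j * qPoch (a ^ 2 * Q ^ n) Q j * qPoch (-(a * b * x)) Q j /
        (qPoch (a * b) Q j * qPoch (Q * a / c) Q j * qPoch Q Q j) * Q ^ j =
      qPoch Q Q n / qPoch (Q * a / c) Q n * ∑ p ∈ antidiagonal n,
        qPoch (a ^ 2 * Q ^ n) Q p.1 * qShiftedPow (-(a * b * x)) (a * b) Q p.1 /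
        qPoch (a * b) Q p.1 * qShiftedPow (a ^ 2 * Q ^ n) (Q * a / c) Q p.2 /
          (qPoch Q Q p.1 * qPoch Q Q p.2) := by
    apply mul_left_cancel₀ (pow_ne_zero (n.choose 2) hq)
    rw [mul_left_comm, ← sum_qPoch_transformation hqq n _ _ _ _ hab,
      ← Finset.Nat.sum_antidiagonal_eq_sum_range_succ (fun j _ ↦
        qPoch (Q ^ (-(n : ℤ))) Q j * qPoch (a ^ 2 * Q ^ n) Q j * qPoch (-(a * b * x)) Q j /
          (qPoch (a * b) Q j * qPoch (Q * a / c) Q j * qPoch Q Q j) * Q ^ j),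
      Finset.mul_sum, Finset.mul_sum]
    refine Finset.sum_congr rfl fun p hp ↦ ?_
    have hp' := mem_antidiagonal.1 hp
    have h1 := qPoch_zpow_neg_mul_qPoch hq p.1 p.2
    have h2 := qPoch_add (Q * a / c) Q p.1 p.2
    rw [hp'] at h1 h2
    have hd := hab p.1 (by omega)
    have hf := hqac p.1 (by omega)
    have hj := hqq p.1
    have hl := hqq p.2
    have hf' : qPoch (Q * a / c * Q ^ p.1) Q p.2 ≠ 0 := right_ne_zero_of_mul (h2 ▸ hfn)
    rw [h2]
    generalize qPoch (Q * a / c * Q ^ p.1) Q p.2 = F' at hf' ⊢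
    generalize qPoch (Q * a / c) Q p.1 = F at hf ⊢
    rw [pow_add] at h1
    field_simp
    linear_combination
      qPoch (a ^ 2 * Q ^ n) Q p.1 * qPoch (-(a * b * x)) Q p.1 * h1
  rw [hright, ← Finset.Nat.sum_antidiagonal_eq_sum_range_succ (fun j _ ↦
      qPoch (a ^ 2 * Q ^ n) Q j * qPoch (Q ^ (-(n : ℤ))) Q j * qPoch (-1 / x) Q j /
        (qPoch (a * b) Q j * qPoch (a * c) Q j * qPoch Q Q j) * (-(b * c * x)) ^ j),
    Finset.mul_sum, Finset.mul_sum]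
  refine Finset.sum_congr rfl fun p hp ↦ ?_
  have hp' := mem_antidiagonal.1 hp
  have h1 := qPoch_mul_qShiftedPow_eq (s := a * c) hq hg p.1 p.2
  have h2 : qShiftedPow (-(a * b * x)) (a * b) Q p.1 =
      (-(a * b * x)) ^ p.1 * qPoch (-1 / x) Q p.1 := by
    rw [← qShiftedPow_mul_right]
    congr 1
    field_simp
  have h3 : (-(b * c * x)) ^ p.1 = (c / a) ^ p.1 * (-(a * b * x)) ^ p.1 := by
    rw [← mul_pow]
    congr 1
    field_simp
  have e1 : c / a * Q ^ (-(n : ℤ)) = c * Q ^ (-(n : ℤ)) / a := by ring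
  have e2 : (c / a)⁻¹ * (a * c) * Q ^ n = a ^ 2 * Q ^ n := by field_simp
  have e3 : (c / a)⁻¹ * Q = Q * a / c := by field_simp
  have e4 : Q / (c / a) = Q * a / c := by field_simp
  rw [hp', e1, e2, e3, e4] at h1
  rw [h2, h3]
  have hd := hab p.1 (by omega)
  have hs := hac p.1 (by omega)
  have hk := hqq p.1
  have hm := hqq p.2
  generalize qPoch (Q * a / c) Q n = F at hfn h1 ⊢
  generalize qShiftedPow (a ^ 2 * Q ^ n) (Q * a / c) Q p.2 = S at h1 ⊢
  generalize qPoch (c * Q ^ (-(n : ℤ)) / a) Q n = G at h1 ⊢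
  generalize (c / a) ^ p.1 = g at h1 ⊢
  generalize qPoch (-1 / x) Q p.1 = B
  generalize (-(a * b * x)) ^ p.1 = u
  field_simp
  linear_combination -(qPoch (a ^ 2 * Q ^ n) Q p.1 * B * u) * h1
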